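/- Fix t > 0 and j ∈ {2,…,M−1}. For every ε > 0 there exists Λ < ∞ such that for every intensity vector λ with λ_j ≥ Λ, the matrix N_t(λ) is invertible and every entry of the j-th column of N_t(λ)^{−1} is at most ε; consequently, for every integer p ≥ 1, every entry of the j-th column of N_t(λ)^{−p} is at most ε. In other words, as λ_j → +∞ (uniformly in the other components of λ), the j-th column of N_t(λ)^{−1}, and hence of N_t(λ)^{−p}, tends to 0. -/

import Mathlib

noncomputable section

open Finset MeasureTheory

/-- Paper index `j ∈ {1,…,M+1}` as an element of `Fin (M+1)`. -/
def fid (M j : ℕ) : Fin (M + 1) := ⟨(j - 1) % (M + 1), Nat.mod_lt _ (Nat.succ_pos M)⟩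

/-- `q_{j,j+1}` built from the grid `i` and the drift `b`. -/
def qup (i b : ℕ → ℝ) (j : ℕ) : ℝ :=
  ((i j - i (j - 1)) / (i (j + 1) - i (j - 1))) * (1 + (i (j + 1) - i j) * b j)

/-- `q_{j,j-1}` built from the grid `i` and the drift `b`. -/
def qdn (i b : ℕ → ℝ) (j : ℕ) : ℝ :=
  ((i (j + 1) - i j) / (i (j + 1) - i (j - 1))) * (1 - (i j - i (j - 1)) * b j)

/-- `k̃_j = (i_{j+1}-i_j)(i_j-i_{j-1}) k_j` for `2 ≤ j ≤ M-1`, and `0` otherwise. -/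
def ktil (M : ℕ) (i k : ℕ → ℝ) (j : ℕ) : ℝ :=
  if 2 ≤ j ∧ j ≤ M - 1 then (i (j + 1) - i j) * (i j - i (j - 1)) * k j else 0

/-- The drift hypothesis `-1/(i_{j+1}-i_j) < b_j < 1/(i_j - i_{j-1})`. -/
def DriftHyp (M : ℕ) (i b : ℕ → ℝ) : Prop :=
  ∀ j, 2 ≤ j → j ≤ M - 1 →
    -(1 / (i (j + 1) - i j)) < b j ∧ b j < 1 / (i j - i (j - 1))

/-- An intensity vector: nonnegative on `{2,…,M-1}` and (by convention) `0` elsewhere. -/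
def IntensityVec (M : ℕ) (lam : ℕ → ℝ) : Prop :=
  (∀ j, 2 ≤ j → j ≤ M - 1 → 0 ≤ lam j) ∧ (∀ j, ¬(2 ≤ j ∧ j ≤ M - 1) → lam j = 0)

/-- `p ∈ 𝕊^M`. -/
def ProbVec (M : ℕ) (p : ℕ → ℝ) : Prop :=
  (∀ j, 1 ≤ j → j ≤ M → 0 < p j) ∧ ∑ j ∈ Finset.Icc 1 M, p j = 1

/-- `κ` are martingale coordinates for `(i,b)`. -/
def MartCoord (M : ℕ) (i b κ : ℕ → ℝ) : Prop :=
  (∀ j, 1 ≤ j → j ≤ M - 1 → κ j < κ (j + 1)) ∧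
  (∀ j, 2 ≤ j → j ≤ M - 1 →
    qup i b j = (κ j - κ (j - 1)) / (κ (j + 1) - κ (j - 1)) ∧
    qdn i b j = (κ (j + 1) - κ j) / (κ (j + 1) - κ (j - 1)))

/-- The point `x₀` of the G-system. -/
def Gx0 (M : ℕ) (s : ℝ) (κ kt P G : ℕ → ℝ) : ℝ :=
  (∑ j ∈ Finset.Icc 1 M, κ j * P j * (1 + s * G j * kt j)) /
    (∑ j ∈ Finset.Icc 1 M, P j * (1 + s * G j * kt j))

/-- `(G, l)` solves the G-system with time parameter `s` and probability vector `P`. -/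
def GSystem (M : ℕ) (s : ℝ) (κ kt P G : ℕ → ℝ) (l : ℕ) : Prop :=
  2 ≤ l ∧ l ≤ M ∧
  (∀ j, 1 ≤ j → j ≤ M → 0 ≤ G j) ∧ G 1 = 0 ∧ G M = 0 ∧
  κ (l - 1) < Gx0 M s κ kt P G ∧ Gx0 M s κ kt P G ≤ κ l ∧
  (∀ j, 2 ≤ j → j ≤ l - 1 →
    G j = (1 / (s * P j)) *
      ((κ (j + 1) - κ (j - 1)) / ((κ (j + 1) - κ j) * (κ j - κ (j - 1)))) *
      ∑ a ∈ Finset.Icc 1 (j - 1), (κ j - κ a) * P a * (1 + s * G a * kt a)) ∧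
  (∀ j, l ≤ j → j ≤ M - 1 →
    G j = (1 / (s * P j)) *
      ((κ (j + 1) - κ (j - 1)) / ((κ (j + 1) - κ j) * (κ j - κ (j - 1)))) *
      ∑ a ∈ Finset.Icc (j + 1) M, (κ a - κ j) * P a * (1 + s * G a * kt a))

/-- Entry `(j,c)` (paper indices in `{1,…,M+1}`) of the matrix `Ñ_t(λ)`. -/
def NtE (M : ℕ) (t : ℝ) (i b k lam : ℕ → ℝ) (j c : ℕ) : ℝ :=
  if 2 ≤ j ∧ j ≤ M - 1 then
    if c = j then 1 + t * lam j * (1 + ktil M i k j)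
    else if c = j + 1 then -(t * lam j * qup i b j)
    else if c = j - 1 then -(t * lam j * qdn i b j)
    else if c = M + 1 then -(t * lam j * ktil M i k j)
    else 0
  else if c = j then 1 else 0

/-- The `(M+1)×(M+1)` matrix `Ñ_t(λ)`. -/
def Ntilde (M : ℕ) (t : ℝ) (i b k lam : ℕ → ℝ) : Matrix (Fin (M + 1)) (Fin (M + 1)) ℝ :=
  Matrix.of fun u v => NtE M t i b k lam (u.1 + 1) (v.1 + 1)

/-- The top-left `M×M` block `N_t(λ)` of `Ñ_t(λ)`. -/
def NMat (M : ℕ) (t : ℝ) (i b k lam : ℕ → ℝ) : Matrix (Fin M) (Fin M) ℝ :=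
  Matrix.of fun u v => NtE M t i b k lam (u.1 + 1) (v.1 + 1)

/-- Entry `(j,c)` (paper indices) of the one-step transition matrix `P̃^{(h)}(λ)`. -/
def PtE (M : ℕ) (h : ℝ) (i b k lam : ℕ → ℝ) (j c : ℕ) : ℝ :=
  if 2 ≤ j ∧ j ≤ M - 1 then
    if c = j then 1 - h * lam j * (1 + ktil M i k j)
    else if c = j + 1 then h * lam j * qup i b j
    else if c = j - 1 then h * lam j * qdn i b j
    else if c = M + 1 then h * lam j * ktil M i k j
    else 0
  else if c = j then 1 else 0

/-- The `(M+1)×(M+1)` transition matrix `P̃^{(h)}(λ)`. -/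
def Ptilde (M : ℕ) (h : ℝ) (i b k lam : ℕ → ℝ) : Matrix (Fin (M + 1)) (Fin (M + 1)) ℝ :=
  Matrix.of fun u v => PtE M h i b k lam (u.1 + 1) (v.1 + 1)

/-- Entry `(j,c)` (paper indices) of the intensity matrix `Θ(λ)`. -/
def ThE (M : ℕ) (i b k lam : ℕ → ℝ) (j c : ℕ) : ℝ :=
  if 2 ≤ j ∧ j ≤ M - 1 then
    if c = j then -(lam j * (1 + ktil M i k j))
    else if c = j + 1 then lam j * qup i b j
    else if c = j - 1 then lam j * qdn i b j
    else if c = M + 1 then lam j * ktil M i k j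
    else 0
  else 0

/-- The `(M+1)×(M+1)` intensity matrix `Θ(λ)`. -/
def Theta (M : ℕ) (i b k lam : ℕ → ℝ) : Matrix (Fin (M + 1)) (Fin (M + 1)) ℝ :=
  Matrix.of fun u v => ThE M i b k lam (u.1 + 1) (v.1 + 1)
lemma qup_pos_and_qdn_pos {M : ℕ} {i b : ℕ → ℝ}
    (hi : ∀ j, 1 ≤ j → j ≤ M - 1 → i j < i (j + 1)) (hb : DriftHyp M i b)
    {j : ℕ} (h2 : 2 ≤ j) (hM : j ≤ M - 1) :
    0 < qup i b j ∧ 0 < qdn i b j ∧ qup i b j + qdn i b j = 1 := by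
  obtain ⟨hlo, hhi⟩ := hb j h2 hM
  have hd : 0 < i (j + 1) - i j := sub_pos.2 (hi j (by omega) hM)
  have ha : 0 < i j - i (j - 1) := by
    have h := hi (j - 1) (by omega) (by omega)
    rw [Nat.sub_add_cancel (by omega : 1 ≤ j)] at h
    exact sub_pos.2 h
  have hs : 0 < i (j + 1) - i (j - 1) := by linarith
  rw [neg_lt, lt_div_iff₀ hd] at hlo
  rw [lt_div_iff₀ ha] at hhi
  refine ⟨mul_pos (div_pos ha hs) (by linarith), mul_pos (div_pos hd hs) (by linarith), ?_⟩
  unfold qup qdn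
  field_simp
  ring

lemma ktil_nonneg {M : ℕ} {i k : ℕ → ℝ}
    (hi : ∀ j, 1 ≤ j → j ≤ M - 1 → i j < i (j + 1))
    (hk : ∀ j, 2 ≤ j → j ≤ M - 1 → 0 ≤ k j) (j : ℕ) : 0 ≤ ktil M i k j := by
  unfold ktil
  split_ifs with h
  · have hd := hi j (by omega) h.2
    have ha := hi (j - 1) (by omega) (by omega)
    rw [Nat.sub_add_cancel (by omega : 1 ≤ j)] at ha
    exact mul_nonneg (mul_nonneg (sub_pos.2 hd).le (sub_pos.2 ha).le) (hk j h.1 h.2)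
  · exact le_rfl

lemma NMat_mulVec_of_boundary {M : ℕ} (t : ℝ) (i b k lam : ℕ → ℝ) (v : Fin M → ℝ) (u : Fin M)
    (hu : ¬(2 ≤ u.1 + 1 ∧ u.1 + 1 ≤ M - 1)) :
    (NMat M t i b k lam).mulVec v u = v u := by
  have h : ∀ c : Fin M, NMat M t i b k lam u c = if c = u then 1 else 0 := by
    intro c
    simp only [NMat, Matrix.of_apply, NtE, if_neg hu, Fin.ext_iff, Nat.add_right_cancel_iff]
  simp [Matrix.mulVec, dotProduct, h]

lemma NMat_mulVec_of_interior {M : ℕ} (t : ℝ) (i b k lam : ℕ → ℝ) (v : Fin M → ℝ) (u : Fin M)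
    (h2 : 2 ≤ u.1 + 1) (hM : u.1 + 1 ≤ M - 1) :
    (NMat M t i b k lam).mulVec v u =
      (1 + t * lam (u.1 + 1) * (1 + ktil M i k (u.1 + 1))) * v u
        - t * lam (u.1 + 1) * (qup i b (u.1 + 1) * v ⟨u.1 + 1, by omega⟩
          + qdn i b (u.1 + 1) * v ⟨u.1 - 1, by omega⟩) := by
  have h : ∀ c : Fin M, NMat M t i b k lam u c =
      (if c = u then 1 + t * lam (u.1 + 1) * (1 + ktil M i k (u.1 + 1)) else 0)
      + (if c = ⟨u.1 + 1, by omega⟩ then -(t * lam (u.1 + 1) * qup i b (u.1 + 1)) else 0)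
      + (if c = ⟨u.1 - 1, by omega⟩ then -(t * lam (u.1 + 1) * qdn i b (u.1 + 1)) else 0) := by
    intro c
    have hc := c.2
    simp only [NMat, Matrix.of_apply, NtE, if_pos (And.intro h2 hM), Fin.ext_iff]
    split_ifs <;> first | omega | simp
  simp only [Matrix.mulVec, dotProduct, h, add_mul, ite_mul, zero_mul, Finset.sum_add_distrib,
    Finset.sum_ite_eq', Finset.mem_univ, if_true]
  ring

/-- Minimum principle for `N_t(λ)`. -/
lemma nonneg_of_NMat_mulVec_nonneg {M : ℕ} {t : ℝ} {i b k lam : ℕ → ℝ} (ht : 0 < t)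
    (hi : ∀ j, 1 ≤ j → j ≤ M - 1 → i j < i (j + 1)) (hb : DriftHyp M i b)
    (hk : ∀ j, 2 ≤ j → j ≤ M - 1 → 0 ≤ k j) (hlam : IntensityVec M lam)
    {v : Fin M → ℝ} (hv : ∀ u, 0 ≤ (NMat M t i b k lam).mulVec v u) (u : Fin M) : 0 ≤ v u := by
  have : Nonempty (Fin M) := ⟨u⟩
  obtain ⟨m, hm⟩ := Finite.exists_min v
  refine le_trans ?_ (hm u)
  have hvm := hv m
  by_cases h : 2 ≤ m.1 + 1 ∧ m.1 + 1 ≤ M - 1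
  · rw [NMat_mulVec_of_interior t i b k lam v m h.1 h.2] at hvm
    obtain ⟨hp, hq, hs⟩ := qup_pos_and_qdn_pos hi hb h.1 h.2
    have hl : 0 ≤ t * lam (m.1 + 1) := mul_nonneg ht.le (hlam.1 _ h.1 h.2)
    have hkt := mul_nonneg hl (ktil_nonneg hi hk (m.1 + 1))
    have h1 := mul_le_mul_of_nonneg_left (hm ⟨m.1 + 1, by omega⟩) hp.le
    have h2 := mul_le_mul_of_nonneg_left (hm ⟨m.1 - 1, by omega⟩) hq.le
    have h3 := mul_le_mul_of_nonneg_left (add_le_add h1 h2) hl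
    rw [← add_mul, hs, one_mul] at h3
    by_contra! hneg
    nlinarith [mul_nonneg hkt (neg_nonneg.2 hneg.le)]
  · rwa [NMat_mulVec_of_boundary t i b k lam v m h] at hvm

lemma isUnit_NMat {M : ℕ} {t : ℝ} {i b k lam : ℕ → ℝ} (ht : 0 < t)
    (hi : ∀ j, 1 ≤ j → j ≤ M - 1 → i j < i (j + 1)) (hb : DriftHyp M i b)
    (hk : ∀ j, 2 ≤ j → j ≤ M - 1 → 0 ≤ k j) (hlam : IntensityVec M lam) :
    IsUnit (NMat M t i b k lam) := by
  rw [← Matrix.mulVec_injective_iff_isUnit]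
  intro v w hvw
  have hvw' : (NMat M t i b k lam).mulVec v = (NMat M t i b k lam).mulVec w := hvw
  funext u
  have h1 := nonneg_of_NMat_mulVec_nonneg ht hi hb hk hlam (v := v - w)
    (by intro c; simp [Matrix.mulVec_sub, hvw']) u
  have h2 := nonneg_of_NMat_mulVec_nonneg ht hi hb hk hlam (v := w - v)
    (by intro c; simp [Matrix.mulVec_sub, hvw']) u
  simp only [Pi.sub_apply] at h1 h2
  linarith

lemma one_le_NMat_mulVec_one {M : ℕ} {t : ℝ} {i b k lam : ℕ → ℝ} (ht : 0 < t)
    (hi : ∀ j, 1 ≤ j → j ≤ M - 1 → i j < i (j + 1)) (hb : DriftHyp M i b)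
    (hk : ∀ j, 2 ≤ j → j ≤ M - 1 → 0 ≤ k j) (hlam : IntensityVec M lam) (u : Fin M) :
    1 ≤ (NMat M t i b k lam).mulVec 1 u := by
  by_cases h : 2 ≤ u.1 + 1 ∧ u.1 + 1 ≤ M - 1
  · rw [NMat_mulVec_of_interior t i b k lam 1 u h.1 h.2]
    obtain ⟨-, -, hs⟩ := qup_pos_and_qdn_pos hi hb h.1 h.2
    have hl : 0 ≤ t * lam (u.1 + 1) := mul_nonneg ht.le (hlam.1 _ h.1 h.2)
    have hkt := mul_nonneg hl (ktil_nonneg hi hk (u.1 + 1))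
    simp only [Pi.one_apply, mul_one, hs]
    linarith
  · rw [NMat_mulVec_of_boundary t i b k lam 1 u h, Pi.one_apply]

/-- `N_t(λ)⁻¹` does not increase upper bounds by nonnegative constants. -/
lemma NMat_inv_mulVec_le {M : ℕ} {t : ℝ} {i b k lam : ℕ → ℝ} (ht : 0 < t)
    (hi : ∀ j, 1 ≤ j → j ≤ M - 1 → i j < i (j + 1)) (hb : DriftHyp M i b)
    (hk : ∀ j, 2 ≤ j → j ≤ M - 1 → 0 ≤ k j) (hlam : IntensityVec M lam)
    {ε : ℝ} (hε : 0 ≤ ε) {w : Fin M → ℝ} (hw : ∀ u, w u ≤ ε) (u : Fin M) :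
    ((NMat M t i b k lam)⁻¹).mulVec w u ≤ ε := by
  have hdet := (Matrix.isUnit_iff_isUnit_det _).1 (isUnit_NMat ht hi hb hk hlam)
  have h := nonneg_of_NMat_mulVec_nonneg ht hi hb hk hlam
    (v := ε • (1 : Fin M → ℝ) - ((NMat M t i b k lam)⁻¹).mulVec w) (by
      intro c
      rw [Matrix.mulVec_sub, Matrix.mulVec_smul, Matrix.mulVec_mulVec,
        Matrix.mul_nonsing_inv _ hdet, Matrix.one_mulVec]
      have h1 := mul_le_mul_of_nonneg_left (one_le_NMat_mulVec_one ht hi hb hk hlam c) hε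
      simp only [Pi.sub_apply, Pi.smul_apply, smul_eq_mul]
      linarith [hw c]) u
  simpa using h

/-- There is a function with values in `[0,1]` that is strictly superharmonic for the
nearest-neighbour walk with transition weights `qup`, `qdn`. -/
lemma exists_strict_superharmonic {M : ℕ} {i b : ℕ → ℝ}
    (hi : ∀ j, 1 ≤ j → j ≤ M - 1 → i j < i (j + 1)) (hb : DriftHyp M i b) :
    ∃ h : ℕ → ℝ, (∀ c, c ≤ M → 0 ≤ h c) ∧ (∀ c, h c ≤ 1) ∧
      ∀ c, 2 ≤ c → c ≤ M - 1 → qup i b c * h (c + 1) + qdn i b c * h (c - 1) < h c := by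
  obtain ⟨R, hR1, hR⟩ : ∃ R : ℝ, 1 ≤ R ∧ ∀ c, 2 ≤ c → c ≤ M - 1 → 1 ≤ qup i b c * R := by
    have hnn : ∀ c ∈ Finset.Icc 2 (M - 1), 0 ≤ (qup i b c)⁻¹ := fun c hc =>
      inv_nonneg.2 (qup_pos_and_qdn_pos hi hb (Finset.mem_Icc.1 hc).1
        (Finset.mem_Icc.1 hc).2).1.le
    refine ⟨1 + ∑ c ∈ Finset.Icc 2 (M - 1), (qup i b c)⁻¹, ?_, fun c h2 hM => ?_⟩
    · linarith [Finset.sum_nonneg hnn]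
    · have hp := (qup_pos_and_qdn_pos hi hb h2 hM).1
      have hle := Finset.single_le_sum hnn (Finset.mem_Icc.2 ⟨h2, hM⟩)
      have h1 := mul_le_mul_of_nonneg_left hle hp.le
      rw [mul_inv_cancel₀ hp.ne'] at h1
      linarith
  have hR0 : 0 < R := by linarith
  refine ⟨fun c => 1 - R ^ c / R ^ M, fun c hc => ?_, fun c => ?_, fun c h2 hM => ?_⟩
  · exact sub_nonneg.2 ((div_le_one (pow_pos hR0 M)).2 (pow_le_pow_right₀ hR1 hc))
  · have : 0 ≤ R ^ c / R ^ M := by positivity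
    linarith
  · obtain ⟨-, hq, hs⟩ := qup_pos_and_qdn_pos hi hb h2 hM
    have h1 : R ^ c ≤ qup i b c * R ^ (c + 1) := by
      rw [pow_succ']
      nlinarith [hR c h2 hM, pow_pos hR0 c]
    have h3 : 0 < qdn i b c * R ^ (c - 1) := mul_pos hq (pow_pos hR0 _)
    have h4 : R ^ c / R ^ M < (qup i b c * R ^ (c + 1) + qdn i b c * R ^ (c - 1)) / R ^ M :=
      div_lt_div_of_pos_right (by linarith) (pow_pos hR0 M)
    have h5 : qup i b c * (1 - R ^ (c + 1) / R ^ M) + qdn i b c * (1 - R ^ (c - 1) / R ^ M)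
        = (qup i b c + qdn i b c)
          - (qup i b c * R ^ (c + 1) + qdn i b c * R ^ (c - 1)) / R ^ M := by ring
    rw [h5, hs]
    linarith

/-- Fix `t > 0` and `j ∈ {2,…,M-1}`. For every `ε > 0` there is a
`Λ < ∞` such that for every intensity vector `λ` with `λ_j ≥ Λ`, the matrix `N_t(λ)` is
invertible and every entry of the `j`-th column of `N_t(λ)^{-1}` (hence of `N_t(λ)^{-p}`
for every integer `p ≥ 1`) is at most `ε`. -/
theorem stmt_9 (M : ℕ) (hM : 3 ≤ M) (i b k : ℕ → ℝ) (t : ℝ) (ht : 0 < t)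
    (hi : ∀ j, 1 ≤ j → j ≤ M - 1 → i j < i (j + 1))
    (hb : DriftHyp M i b)
    (hk : ∀ j, 2 ≤ j → j ≤ M - 1 → 0 ≤ k j)
    (j : ℕ) (hj2 : 2 ≤ j) (hjM : j ≤ M - 1) :
    ∀ ε : ℝ, 0 < ε → ∃ Λ : ℝ,
      ∀ lam : ℕ → ℝ, IntensityVec M lam → Λ ≤ lam j →
        IsUnit (NMat M t i b k lam) ∧
        (∀ u : Fin M,
          (NMat M t i b k lam)⁻¹ u ⟨(j - 1) % M, Nat.mod_lt _ (by omega)⟩ ≤ ε) ∧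
        (∀ p : ℕ, 1 ≤ p → ∀ u : Fin M,
          ((NMat M t i b k lam)⁻¹ ^ p) u ⟨(j - 1) % M, Nat.mod_lt _ (by omega)⟩ ≤ ε) := by
  intro ε hε
  obtain ⟨h, h0, h1, hlt⟩ := exists_strict_superharmonic hi hb
  set δ : ℝ := h j - (qup i b j * h (j + 1) + qdn i b j * h (j - 1)) with hδ
  have hδ0 : 0 < δ := sub_pos.2 (hlt j hj2 hjM)
  refine ⟨1 / (t * ε * δ), fun lam hlam hΛ => ?_⟩
  have hunit := isUnit_NMat ht hi hb hk hlam
  have hdet := (Matrix.isUnit_iff_isUnit_det _).1 hunit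
  have hcol : ∀ u : Fin M,
      (NMat M t i b k lam)⁻¹ u ⟨(j - 1) % M, Nat.mod_lt _ (by omega)⟩ ≤ ε := by
    intro u
    set a : Fin M := ⟨(j - 1) % M, Nat.mod_lt _ (by omega)⟩ with ha
    have haj : a.1 + 1 = j := by
      simp only [ha]
      rw [Nat.mod_eq_of_lt (by omega)]
      omega
    have hpos := nonneg_of_NMat_mulVec_nonneg ht hi hb hk hlam
      (v := (fun c : Fin M => ε * h (c.1 + 1)) -
        ((NMat M t i b k lam)⁻¹).mulVec (Pi.single a 1)) (by
        intro c
        rw [Matrix.mulVec_sub, Matrix.mulVec_mulVec, Matrix.mul_nonsing_inv _ hdet,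
          Matrix.one_mulVec, Pi.sub_apply, sub_nonneg]
        by_cases hc : 2 ≤ c.1 + 1 ∧ c.1 + 1 ≤ M - 1
        · rw [NMat_mulVec_of_interior t i b k lam _ c hc.1 hc.2]
          have hl : 0 ≤ t * lam (c.1 + 1) := mul_nonneg ht.le (hlam.1 _ hc.1 hc.2)
          have hh : 0 ≤ ε * h (c.1 + 1) := mul_nonneg hε.le (h0 _ (by omega))
          have hkt := mul_nonneg (mul_nonneg hl (ktil_nonneg hi hk (c.1 + 1))) hh
          have hsup := hlt _ hc.1 hc.2
          simp only [show c.1 - 1 + 1 = c.1 + 1 - 1 by omega]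
          by_cases hca : c = a
          · subst hca
            rw [haj] at *
            have hbig : 1 ≤ t * lam j * (ε * δ) := by
              rw [div_le_iff₀ (by positivity)] at hΛ
              linarith
            rw [Pi.single_eq_same]
            rw [hδ] at hbig
            linarith
          · rw [Pi.single_eq_of_ne hca]
            have := mul_nonneg hl (mul_nonneg hε.le (sub_pos.2 hsup).le)
            linarith
        · rw [NMat_mulVec_of_boundary t i b k lam _ c hc, Pi.single_eq_of_ne]
          · exact mul_nonneg hε.le (h0 _ (by omega))
          · rintro rfl
            exact hc (by omega)) u
    simp only [Pi.sub_apply, Matrix.mulVec_single_one, Matrix.col_apply] at hpos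
    have := mul_le_mul_of_nonneg_left (h1 (u.1 + 1)) hε.le
    linarith
  refine ⟨hunit, hcol, fun p hp => ?_⟩
  induction p, hp using Nat.le_induction with
  | base => simpa using hcol
  | succ p _ ih =>
    intro u
    rw [pow_succ']
    exact NMat_inv_mulVec_le ht hi hb hk hlam hε.le ih u
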